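/- arXiv:2604.09410 — 2 statements merged into one kernel-verified Lean document; each statement's English description precedes it below -/
import Mathlib

section
/- Extreme points of the EPU-invariant set. Fix d ≥ 2, N ≥ 1 and E : Fin d → ℝ, with H the diagonal N-qudit Hamiltonian H(x,x) = Σ_{j<N} E(x j), and let S_H be the convex set of EPU-invariant density matrices. Then the extreme points of S_H are exactly the normalized shell projectors ρ_Е := P_Е/g(Е), one for each achievable total energy Е. -/
open scoped Classical ComplexOrder
open Matrix

noncomputable section

/-- Strings of `N` qudits with `d` levels. -/
abbrev QString (d N : ℕ) := Fin N → Fin d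

/-- Matrices on `N` qudits. -/
abbrev QMat (d N : ℕ) := Matrix (QString d N) (QString d N) ℂ

/-- Total energy of a basis string. -/
def totalEnergy {d N : ℕ} (E : Fin d → ℝ) (x : QString d N) : ℝ := ∑ j, E (x j)

/-- The noninteracting total Hamiltonian (diagonal in the energy eigenbasis). -/
def Hqudit (d N : ℕ) (E : Fin d → ℝ) : QMat d N :=
  Matrix.diagonal fun x => (totalEnergy E x : ℂ)

/-- The projector onto the shell of total energy `En`. -/
def shellProj (d N : ℕ) (E : Fin d → ℝ) (En : ℝ) : QMat d N :=
  Matrix.diagonal fun x => if totalEnergy E x = En then (1 : ℂ) else 0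

/-- `g(En)`: the number of basis strings of total energy `En` (the trace of `shellProj`). -/
def shellDim (d N : ℕ) (E : Fin d → ℝ) (En : ℝ) : ℕ :=
  (Finset.univ.filter fun x : QString d N => totalEnergy E x = En).card

/-- The finite set of achievable total energies. -/
def energyLevels (d N : ℕ) (E : Fin d → ℝ) : Finset ℝ :=
  Finset.univ.image fun x : QString d N => totalEnergy E x

/-- A density matrix: positive semidefinite with unit trace. -/
def IsDensityMatrix {n : Type*} [Fintype n] [DecidableEq n] (ρ : Matrix n n ℂ) : Prop :=
  ρ.PosSemidef ∧ ρ.trace = 1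

/-- Invariance under every energy-preserving unitary. -/
def IsEPUInvariant (d N : ℕ) (E : Fin d → ℝ) (ρ : QMat d N) : Prop :=
  ∀ U : QMat d N, U ∈ Matrix.unitaryGroup (QString d N) ℂ →
    U * Hqudit d N E = Hqudit d N E * U → U * ρ * Uᴴ = ρ

section EnergyDiag

variable {d N : ℕ} {E : Fin d → ℝ}

/-- The diagonal matrix whose entries depend on the total energy only, through `c`. -/
def energyDiag (d N : ℕ) (E : Fin d → ℝ) (c : ℝ → ℝ) : QMat d N :=
  Matrix.diagonal fun x => (c (totalEnergy E x) : ℂ)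

lemma energyDiag_apply_self (c : ℝ → ℝ) (x : QString d N) :
    energyDiag d N E c x x = (c (totalEnergy E x) : ℂ) := by
  simp [energyDiag]

/-- Entries of a matrix commuting with `Hqudit` between different energies vanish. -/
lemma apply_eq_zero_of_comm_Hqudit {U : QMat d N} (hU : U * Hqudit d N E = Hqudit d N E * U)
    {x y : QString d N} (hxy : totalEnergy E x ≠ totalEnergy E y) : U x y = 0 := by
  have h := congrFun (congrFun hU x) y
  simp only [Hqudit, Matrix.mul_diagonal, Matrix.diagonal_mul] at h
  have h2 : ((totalEnergy E x : ℂ) - totalEnergy E y) * U x y = 0 := by linear_combination -h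
  refine (mul_eq_zero.1 h2).resolve_left fun h3 => hxy ?_
  exact_mod_cast sub_eq_zero.1 h3

lemma isEPUInvariant_energyDiag (c : ℝ → ℝ) : IsEPUInvariant d N E (energyDiag d N E c) := by
  intro U hU hUH
  have hcomm : U * energyDiag d N E c = energyDiag d N E c * U := by
    ext x y
    simp only [energyDiag, Matrix.mul_diagonal, Matrix.diagonal_mul]
    by_cases hxy : totalEnergy E x = totalEnergy E y
    · rw [hxy, mul_comm]
    · simp [apply_eq_zero_of_comm_Hqudit hUH hxy]
  have hUU : U * Uᴴ = 1 := Matrix.mem_unitaryGroup_iff.1 hU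
  rw [hcomm, Matrix.mul_assoc, hUU, Matrix.mul_one]

lemma IsEPUInvariant.apply_eq_zero {ρ : QMat d N} (h : IsEPUInvariant d N E ρ)
    {x y : QString d N} (hxy : x ≠ y) : ρ x y = 0 := by
  let v : QString d N → ℂ := fun z => if z = x then -1 else 1
  have hU : Matrix.diagonal v ∈ Matrix.unitaryGroup (QString d N) ℂ := by
    rw [Matrix.mem_unitaryGroup_iff, Matrix.star_eq_conjTranspose, Matrix.diagonal_conjTranspose,
      Matrix.diagonal_mul_diagonal, ← Matrix.diagonal_one]
    congr 1
    funext z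
    by_cases hz : z = x <;> simp [v, hz]
  have hρ := h _ hU (by simp only [Hqudit, Matrix.diagonal_mul_diagonal, mul_comm])
  have h2 := congrFun (congrFun hρ x) y
  rw [Matrix.diagonal_conjTranspose, Matrix.mul_diagonal, Matrix.diagonal_mul] at h2
  simp only [v, Pi.star_apply, if_true, if_neg hxy.symm, star_one] at h2
  linear_combination (-1 / 2 : ℂ) * h2

lemma IsEPUInvariant.apply_self_eq {ρ : QMat d N} (h : IsEPUInvariant d N E ρ)
    {x y : QString d N} (hxy : totalEnergy E x = totalEnergy E y) : ρ x x = ρ y y := by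
  let σ := Equiv.swap x y
  have hσ : ∀ z, totalEnergy E (σ z) = totalEnergy E z := by
    intro z
    by_cases hzx : z = x
    · simp [σ, hzx, hxy]
    by_cases hzy : z = y
    · simp [σ, hzy, hxy]
    simp [σ, Equiv.swap_apply_of_ne_of_ne hzx hzy]
  let U : QMat d N := Matrix.of fun a b => if σ a = b then 1 else 0
  have hconj : ∀ (M : QMat d N) (a b), (U * M * Uᴴ) a b = M (σ a) (σ b) := by
    intro M a b
    simp [U, Matrix.mul_apply, Matrix.conjTranspose_apply]
  have hU : U ∈ Matrix.unitaryGroup (QString d N) ℂ := by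
    rw [Matrix.mem_unitaryGroup_iff, Matrix.star_eq_conjTranspose]
    ext a b
    have := hconj 1 a b
    rw [Matrix.mul_one] at this
    rw [this, Matrix.one_apply, Matrix.one_apply]
    simp
  have hUH : U * Hqudit d N E = Hqudit d N E * U := by
    ext a b
    simp only [Hqudit, Matrix.mul_diagonal, Matrix.diagonal_mul]
    by_cases hab : σ a = b
    · rw [← hab, hσ, mul_comm]
    · simp [U, hab]
  have h2 := congrFun (congrFun (h U hU hUH) y) y
  rw [hconj] at h2
  simpa [σ] using h2

/-- EPU-invariant density matrices are given by probability weights that depend on energy only. -/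
lemma isDensityMatrix_and_isEPUInvariant_iff (ρ : QMat d N) :
    IsDensityMatrix ρ ∧ IsEPUInvariant d N E ρ ↔
      ∃ c : ℝ → ℝ, (∀ x : QString d N, 0 ≤ c (totalEnergy E x)) ∧
        ∑ x : QString d N, c (totalEnergy E x) = 1 ∧ ρ = energyDiag d N E c := by
  constructor
  · rintro ⟨⟨hpos, htr⟩, hinv⟩
    let c : ℝ → ℝ := fun e => if h : ∃ x : QString d N, totalEnergy E x = e
      then (ρ h.choose h.choose).re else 0
    have hc : ∀ x : QString d N, (c (totalEnergy E x) : ℂ) = ρ x x := by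
      intro x
      have hx : ∃ y : QString d N, totalEnergy E y = totalEnergy E x := ⟨x, rfl⟩
      simp only [c, dif_pos hx]
      rw [hinv.apply_self_eq hx.choose_spec]
      exact (Complex.eq_re_of_ofReal_le (r := 0) (by simpa using hpos.diag_nonneg)).symm
    refine ⟨c, fun x => ?_, ?_, ?_⟩
    · have := hpos.diag_nonneg (i := x)
      rw [← hc] at this
      exact_mod_cast this
    · have : ∑ x : QString d N, (c (totalEnergy E x) : ℂ) = 1 := by
        simp_rw [hc]
        exact htr
      exact_mod_cast this
    · ext x y
      by_cases hxy : x = y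
      · rw [← hxy, energyDiag_apply_self, hc]
      · simp [hinv.apply_eq_zero hxy, energyDiag, hxy]
  · rintro ⟨c, hc, hsum, rfl⟩
    refine ⟨⟨?_, ?_⟩, isEPUInvariant_energyDiag c⟩
    · exact Matrix.posSemidef_diagonal_iff.2 fun x => by exact_mod_cast hc x
    · rw [energyDiag, Matrix.trace_diagonal]
      exact_mod_cast hsum

/-- The uniform weight on the shell of energy `En`. -/
def shellWeight (d N : ℕ) (E : Fin d → ℝ) (En e : ℝ) : ℝ :=
  if e = En then (shellDim d N E En : ℝ)⁻¹ else 0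

lemma energyDiag_shellWeight (En : ℝ) :
    energyDiag d N E (shellWeight d N E En) =
      ((shellDim d N E En : ℂ))⁻¹ • shellProj d N E En := by
  rw [energyDiag, shellProj, ← Matrix.diagonal_smul]
  congr 1
  funext x
  by_cases hx : totalEnergy E x = En <;> simp [shellWeight, hx]

lemma shellWeight_nonneg (En e : ℝ) : 0 ≤ shellWeight d N E En e := by
  unfold shellWeight
  split_ifs <;> positivity

lemma shellDim_totalEnergy_pos (x : QString d N) : 0 < shellDim d N E (totalEnergy E x) :=
  Finset.card_pos.2 ⟨x, by simp⟩

/-- The total weight of an energy function supported on one shell. -/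
lemma sum_eq_shellDim_mul {c : ℝ → ℝ} {En : ℝ}
    (hc : ∀ x : QString d N, totalEnergy E x ≠ En → c (totalEnergy E x) = 0) :
    ∑ x : QString d N, c (totalEnergy E x) = shellDim d N E En * c En := by
  have : ∀ x : QString d N, c (totalEnergy E x) = if totalEnergy E x = En then c En else 0 := by
    intro x
    split_ifs with hx
    · rw [hx]
    · exact hc x hx
  simp_rw [this]
  rw [← Finset.sum_filter, Finset.sum_const, nsmul_eq_mul, shellDim]

lemma sum_shellWeight (x₀ : QString d N) :
    ∑ x : QString d N, shellWeight d N E (totalEnergy E x₀) (totalEnergy E x) = 1 := by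
  rw [sum_eq_shellDim_mul (En := totalEnergy E x₀) fun x hx => if_neg hx, shellWeight, if_pos rfl]
  exact mul_inv_cancel₀ (by exact_mod_cast (shellDim_totalEnergy_pos x₀).ne')

lemma energyDiag_eq_shellWeight {c : ℝ → ℝ} {En : ℝ}
    (hsum : ∑ x : QString d N, c (totalEnergy E x) = 1)
    (hc : ∀ x : QString d N, totalEnergy E x ≠ En → c (totalEnergy E x) = 0) :
    energyDiag d N E c = energyDiag d N E (shellWeight d N E En) := by
  rw [sum_eq_shellDim_mul hc] at hsum
  unfold energyDiag
  congr 1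
  funext x
  by_cases hx : totalEnergy E x = En
  · rw [shellWeight, if_pos hx, hx, eq_inv_of_mul_eq_one_right hsum]
  · rw [shellWeight, if_neg hx, hc x hx]

lemma smul_energyDiag_add_smul (s t : ℝ) (a b : ℝ → ℝ) :
    s • energyDiag d N E a + t • energyDiag d N E b =
      energyDiag d N E fun e => s * a e + t * b e := by
  ext x y
  by_cases hxy : x = y <;> simp [energyDiag, hxy]

end EnergyDiag

/-- **Extreme points of the EPU-invariant set** are exactly the normalized shell projectors. -/
theorem extremePoints_EPUInvariant (d N : ℕ) (hd : 2 ≤ d) (hN : 1 ≤ N) (E : Fin d → ℝ) :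
    Set.extremePoints ℝ {ρ : QMat d N | IsDensityMatrix ρ ∧ IsEPUInvariant d N E ρ} =
      {ρ : QMat d N | ∃ En ∈ energyLevels d N E,
        ρ = ((shellDim d N E En : ℂ))⁻¹ • shellProj d N E En} := by
  ext ρ
  simp only [Set.extremePoints, Set.mem_ofPred_eq, ← energyDiag_shellWeight,
    isDensityMatrix_and_isEPUInvariant_iff]
  constructor
  · rintro ⟨⟨c, hc, hsum, rfl⟩, hext⟩
    obtain ⟨x₀, hx₀⟩ : ∃ x : QString d N, c (totalEnergy E x) ≠ 0 := by
      by_contra! h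
      simp [h] at hsum
    set e₀ := totalEnergy E x₀ with he₀
    have hg : (0 : ℝ) < shellDim d N E e₀ := by exact_mod_cast shellDim_totalEnergy_pos x₀
    have hc₀ : 0 < c e₀ := (hc x₀).lt_of_ne' hx₀
    set p : ℝ := shellDim d N E e₀ * c e₀ with hp
    have hp0 : 0 < p := mul_pos hg hc₀
    -- the part of the weight off the shell through `x₀`
    let r : ℝ → ℝ := fun e => c e - p * shellWeight d N E e₀ e
    have hr_shell : r e₀ = 0 := by
      simp only [r, shellWeight, if_true, hp]
      field_simp
      ring
    have hr_off : ∀ e, e ≠ e₀ → r e = c e := fun e he => by simp [r, shellWeight, he]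
    have hr : ∀ x : QString d N, 0 ≤ r (totalEnergy E x) := by
      intro x
      by_cases hx : totalEnergy E x = e₀
      · rw [hx, hr_shell]
      · rw [hr_off _ hx]
        exact hc x
    have hrsum : ∑ x : QString d N, r (totalEnergy E x) = 1 - p := by
      simp only [r]
      rw [Finset.sum_sub_distrib, ← Finset.mul_sum, hsum, sum_shellWeight, mul_one]
    refine ⟨e₀, Finset.mem_image_of_mem _ (Finset.mem_univ x₀), ?_⟩
    rcases (Finset.sum_nonneg fun x _ => hr x).eq_or_lt with h0 | hpos
    · refine energyDiag_eq_shellWeight hsum fun x hx => ?_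
      rw [← hr_off _ hx]
      exact (Finset.sum_eq_zero_iff_of_nonneg fun x _ => hr x).1 h0.symm x (Finset.mem_univ x)
    · rw [hrsum] at hpos
      refine (hext ⟨_, fun x => shellWeight_nonneg e₀ _, sum_shellWeight x₀, rfl⟩
        (x₂ := energyDiag d N E fun e => (1 - p)⁻¹ * r e)
        ⟨fun e => (1 - p)⁻¹ * r e, fun x => mul_nonneg (inv_nonneg.2 hpos.le) (hr x), ?_, rfl⟩
        ⟨p, 1 - p, hp0, hpos, by ring, ?_⟩).symm
      · rw [← Finset.mul_sum, hrsum, inv_mul_cancel₀ hpos.ne']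
      · rw [smul_energyDiag_add_smul]
        congr 1
        funext e
        rw [mul_inv_cancel_left₀ hpos.ne']
        simp only [r]
        ring
  · rintro ⟨En, hEn, rfl⟩
    obtain ⟨x₀, -, rfl⟩ := Finset.mem_image.1 hEn
    refine ⟨⟨_, fun x => shellWeight_nonneg _ _, sum_shellWeight x₀, rfl⟩, ?_⟩
    rintro _ ⟨a, ha, hasum, rfl⟩ _ ⟨b, hb, -, rfl⟩ ⟨s, t, hs, ht, -, hst⟩
    refine energyDiag_eq_shellWeight hasum fun x hx => ?_
    rw [smul_energyDiag_add_smul] at hst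
    have h := congrFun (congrFun hst x) x
    simp only [energyDiag_apply_self, shellWeight, if_neg hx] at h
    have h' : s * a (totalEnergy E x) + t * b (totalEnergy E x) = 0 := by exact_mod_cast h
    have h1 := mul_nonneg hs.le (ha x)
    have h2 := mul_nonneg ht.le (hb x)
    exact (mul_eq_zero.1 (by linarith : s * a (totalEnergy E x) = 0)).resolve_left hs.ne'

end
end

section
/- Trace-norm bound between the shell marginal and the mixture of product states (norm1 bound in the proof of Theorem 1). Fix d ≥ 2, a map E : Fin d → ℝ, integers 1 ≤ k ≤ N, and an achievable total energy Е. Let p be the probability distribution on (Fin d)^k given by p(y) := #{x : Fin N → Fin d : Σ_j E(x j) = Е and x_i = y_i for all i < k}/g(Е) (the law of the first k letters of a uniformly random length-N string of total energy Е), and let q(y) := Σ_{P∈S(Е)} μ_Е(P)·∏_{i<k} P(y_i). Then Σ_{y ∈ (Fin d)^k} |p(y) − q(y)| ≤ 2kd/N. (Equivalently, ‖ tr_{N−k}(P_Е/g(Е)) − Σ_{P∈S(Е)} μ_Е(P)·η_P^{⊗k} ‖₁ ≤ 2kd/N, both matrices being diagonal with diagonals p and q.) -/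
open scoped Classical

noncomputable section

/-- The number of occurrences of the letter `j` in the string `y`. -/
def letterCount {d k : ℕ} (y : Fin k → Fin d) (j : Fin d) : ℕ :=
  (Finset.univ.filter fun i => y i = j).card

/-- `|T_P|`: the number of length-`N` strings whose letter counts are `n` (type `P = n/N`). -/
def typeClassCard (d N : ℕ) (n : Fin d → ℕ) : ℕ :=
  (Finset.univ.filter fun x : Fin N → Fin d => ∀ j, letterCount x j = n j).card

/-- `S(Е)`: the types of length-`N` strings of total energy `En`, represented by their
count vectors `n` (the type is `P = n/N`). -/
def typesOfEnergy (d N : ℕ) (E : Fin d → ℝ) (En : ℝ) : Finset (Fin d → ℕ) :=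
  ((Finset.univ : Finset (Fin d → Fin (N + 1))).image fun n j => (n j : ℕ)).filter
    fun n => (∑ j, n j = N) ∧ (∑ j, (n j : ℝ) * E j) = En

/-- `g(Е) = Σ_{P ∈ S(Е)} |T_P|`: the number of length-`N` strings of total energy `En`. -/
def gE (d N : ℕ) (E : Fin d → ℝ) (En : ℝ) : ℕ :=
  ∑ n ∈ typesOfEnergy d N E En, typeClassCard d N n

/-- `μ_Е(P) = |T_P| / g(Е)`. -/
def muE (d N : ℕ) (E : Fin d → ℝ) (En : ℝ) (n : Fin d → ℕ) : ℝ :=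
  (typeClassCard d N n : ℝ) / (gE d N E En : ℝ)

/-- The number of length-`N` strings of total energy `En` whose first `k` letters are `y`. -/
def prefixCount (d N k : ℕ) (hk : k ≤ N) (E : Fin d → ℝ) (En : ℝ) (y : Fin k → Fin d) : ℕ :=
  (Finset.univ.filter fun x : Fin N → Fin d =>
    (∑ j, E (x j)) = En ∧ ∀ i : Fin k, x (Fin.castLE hk i) = y i).card

theorem one_sub_sum_le_prod_one_sub {ι : Type*} (s : Finset ι) (f : ι → ℝ)
    (h0 : ∀ i ∈ s, 0 ≤ f i) (h1 : ∀ i ∈ s, f i ≤ 1) :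
    1 - ∑ i ∈ s, f i ≤ ∏ i ∈ s, (1 - f i) := by
  induction s using Finset.induction_on with
  | empty => simp
  | insert a s ha ih =>
    rw [Finset.sum_insert ha, Finset.prod_insert ha]
    have ih' := ih (fun i hi => h0 i (Finset.mem_insert_of_mem hi))
      (fun i hi => h1 i (Finset.mem_insert_of_mem hi))
    have ha0 := h0 a (Finset.mem_insert_self a s)
    have ha1 := h1 a (Finset.mem_insert_self a s)
    have hs : 0 ≤ ∑ i ∈ s, f i :=
      Finset.sum_nonneg fun i hi => h0 i (Finset.mem_insert_of_mem hi)
    nlinarith [mul_le_mul_of_nonneg_left ih' (sub_nonneg.2 ha1), mul_nonneg ha0 hs]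

theorem letterCount_comp_perm {d k : ℕ} (y : Fin k → Fin d) (σ : Equiv.Perm (Fin k))
    (j : Fin d) : letterCount (y ∘ σ) j = letterCount y j := by
  unfold letterCount
  exact Finset.card_equiv σ (by simp)

theorem sum_letterCount {d k : ℕ} (y : Fin k → Fin d) : ∑ j, letterCount y j = k := by
  have h := Finset.card_eq_sum_card_fiberwise (f := y) (s := Finset.univ) (t := Finset.univ)
    (by simp)
  simpa [letterCount] using h.symm

/-- The strings with letter counts `n` that agree with `z` on the positions in `A`. -/
def typeCylinder {d N : ℕ} (n : Fin d → ℕ) (A : Finset (Fin N)) (z : Fin N → Fin d) :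
    Finset (Fin N → Fin d) :=
  Finset.univ.filter fun x => (∀ j, letterCount x j = n j) ∧ ∀ i ∈ A, x i = z i

/-- The number of positions in `A` at which `z` has the letter `j`. -/
def letterCountOn {d N : ℕ} (A : Finset (Fin N)) (z : Fin N → Fin d) (j : Fin d) : ℕ :=
  (A.filter fun i => z i = j).card

section Cylinder

variable {d N : ℕ} {n : Fin d → ℕ} {A : Finset (Fin N)} {z : Fin N → Fin d}

theorem mem_typeCylinder {x : Fin N → Fin d} :
    x ∈ typeCylinder n A z ↔ (∀ j, letterCount x j = n j) ∧ ∀ i ∈ A, x i = z i := by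
  simp [typeCylinder]

theorem card_typeCylinder_empty (n : Fin d → ℕ) (z : Fin N → Fin d) :
    (typeCylinder n ∅ z).card = typeClassCard d N n := by
  simp [typeCylinder, typeClassCard]

theorem letterCountOn_congr {x : Fin N → Fin d} (h : ∀ i ∈ A, x i = z i) (j : Fin d) :
    letterCountOn A x j = letterCountOn A z j := by
  unfold letterCountOn
  congr 1
  exact Finset.filter_congr fun i hi => by rw [h i hi]

theorem letterCountOn_le_letterCount (A : Finset (Fin N)) (z : Fin N → Fin d) (j : Fin d) :
    letterCountOn A z j ≤ letterCount z j :=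
  Finset.card_le_card (Finset.filter_subset_filter _ (Finset.subset_univ _))

theorem letterCountOn_compl_add (A : Finset (Fin N)) (z : Fin N → Fin d) (j : Fin d) :
    letterCountOn Aᶜ z j + letterCountOn A z j = letterCount z j := by
  unfold letterCountOn letterCount
  rw [← Finset.card_union_of_disjoint, ← Finset.filter_union, Finset.union_comm,
    Finset.union_compl]
  exact Finset.disjoint_filter_filter disjoint_compl_left

theorem sum_letterCountOn (A : Finset (Fin N)) (z : Fin N → Fin d) :
    ∑ j, letterCountOn A z j = A.card :=
  (Finset.card_eq_sum_card_fiberwise (f := z) (by simp)).symm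

theorem letterCountOn_insert {i : Fin N} (hi : i ∉ A) (j : Fin d) :
    letterCountOn (insert i A) z j = letterCountOn A z j + if z i = j then 1 else 0 := by
  unfold letterCountOn
  rw [Finset.filter_insert]
  split_ifs with h
  · rw [Finset.card_insert_of_notMem (by simp [hi])]
  · rfl

theorem card_typeCylinder_filter_apply_eq {i i' : Fin N} (hi : i ∉ A) (hi' : i' ∉ A)
    (j : Fin d) :
    ((typeCylinder n A z).filter fun x => x i = j).card =
      ((typeCylinder n A z).filter fun x => x i' = j).card := by
  refine Finset.card_equiv ((Equiv.swap i i').arrowCongr (Equiv.refl _)) fun x => ?_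
  have hx : (Equiv.swap i i').arrowCongr (Equiv.refl (Fin d)) x = x ∘ Equiv.swap i i' := by
    ext; simp
  rw [hx]
  simp only [Finset.mem_filter, mem_typeCylinder, letterCount_comp_perm, Function.comp_apply,
    Equiv.swap_apply_right]
  refine and_congr_left fun _ => and_congr_right fun _ => forall₂_congr fun l hl => ?_
  rw [Equiv.swap_apply_of_ne_of_ne (by rintro rfl; exact hi hl) (by rintro rfl; exact hi' hl)]

theorem typeCylinder_insert (i : Fin N) :
    typeCylinder n (insert i A) z = (typeCylinder n A z).filter fun x => x i = z i := by
  ext x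
  simp only [mem_typeCylinder, Finset.mem_filter, Finset.forall_mem_insert]
  tauto

theorem card_typeCylinder_insert_mul {i : Fin N} (hi : i ∉ A) :
    ((typeCylinder n (insert i A) z).card : ℝ) * ((N : ℝ) - A.card) =
      (typeCylinder n A z).card * ((n (z i) : ℝ) - letterCountOn A z (z i)) := by
  have h : ∑ i' ∈ Aᶜ, ((typeCylinder n A z).filter fun x => x i' = z i).card =
      ∑ x ∈ typeCylinder n A z, letterCountOn Aᶜ x (z i) := by
    simp only [letterCountOn, Finset.card_filter]
    exact Finset.sum_comm
  rw [Finset.sum_congr rfl fun i' hi' => card_typeCylinder_filter_apply_eq (i' := i)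
    (Finset.mem_compl.1 hi') hi (z i), Finset.sum_const, ← typeCylinder_insert,
    Finset.card_compl, Fintype.card_fin, smul_eq_mul] at h
  have hA : A.card ≤ N := by simpa using Finset.card_le_univ A
  have h' := congrArg (Nat.cast : ℕ → ℝ) h
  rw [Nat.cast_mul, Nat.cast_sub hA, Nat.cast_sum] at h'
  rw [mul_comm, h', ← nsmul_eq_mul, ← Finset.sum_const]
  refine Finset.sum_congr rfl fun x hx => ?_
  rw [mem_typeCylinder] at hx
  rw [← hx.1 (z i), ← letterCountOn_compl_add A x (z i), letterCountOn_congr hx.2]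
  push_cast
  ring

theorem card_typeCylinder_mul_prod_le (hn : ∑ j, n j = N) (A : Finset (Fin N))
    (z : Fin N → Fin d) :
    ((typeCylinder n A z).card : ℝ) * ∏ j, (1 - (letterCountOn A z j : ℝ) / n j) ≤
      typeClassCard d N n * (∏ i ∈ A, (n (z i) : ℝ) / N) * (1 - (A.card : ℝ) / N) := by
  induction hk : A.card generalizing A with
  | zero =>
    obtain rfl := Finset.card_eq_zero.1 hk
    simp [card_typeCylinder_empty, letterCountOn]
  | succ k ih =>
    have hkN : k + 1 ≤ N := hk ▸ by simpa using Finset.card_le_univ A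
    have hkN' : (k : ℝ) + 1 ≤ N := by exact_mod_cast hkN
    have hN : (0 : ℝ) < N := by linarith [k.cast_nonneg (α := ℝ)]
    rcases (typeCylinder n A z).eq_empty_or_nonempty with h0 | ⟨x, hx⟩
    · rw [h0, Finset.card_empty, Nat.cast_zero, zero_mul]
      have : ((k + 1 : ℕ) : ℝ) / N ≤ 1 := by
        rw [div_le_one hN]; exact_mod_cast hkN
      exact mul_nonneg (by positivity) (by linarith)
    rw [mem_typeCylinder] at hx
    have hle : ∀ j, letterCountOn A z j ≤ n j := fun j => by
      rw [← hx.1 j, ← letterCountOn_congr hx.2]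
      exact letterCountOn_le_letterCount A x j
    obtain ⟨i, hi, hmax⟩ : ∃ i ∈ A, (k + 1) * n (z i) ≤ letterCountOn A z (z i) * N := by
      by_contra! hlt
      have hle' : ∀ j, letterCountOn A z j * N ≤ (k + 1) * n j := fun j => by
        rcases (A.filter fun i => z i = j).eq_empty_or_nonempty with hj | ⟨i, hij⟩
        · simp [letterCountOn, hj]
        · obtain ⟨hiA, rfl⟩ := Finset.mem_filter.1 hij
          exact (hlt i hiA).le
      obtain ⟨i, hiA⟩ : A.Nonempty := Finset.card_pos.1 (by omega)
      have := Finset.sum_lt_sum (fun j _ => hle' j) ⟨z i, Finset.mem_univ _, hlt i hiA⟩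
      rw [← Finset.sum_mul, ← Finset.mul_sum, sum_letterCountOn, hn, hk] at this
      exact lt_irrefl _ this
    obtain ⟨B, hB, rfl⟩ : ∃ B, i ∉ B ∧ insert i B = A :=
      ⟨A.erase i, Finset.notMem_erase i A, Finset.insert_erase hi⟩
    have hBk : B.card = k := by
      rw [Finset.card_insert_of_notMem hB] at hk; omega
    have hC := card_typeCylinder_insert_mul (n := n) (z := z) hB
    have ihB := ih B hBk
    set m := letterCountOn B z (z i) with hm
    have hmi : letterCountOn (insert i B) z (z i) = m + 1 := by
      simp [letterCountOn_insert hB, hm]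
    have hmn : (m : ℝ) + 1 ≤ n (z i) := by
      have := hle (z i)
      rw [hmi] at this
      exact_mod_cast this
    have hn0 : (0 : ℝ) < n (z i) := by linarith [m.cast_nonneg (α := ℝ)]
    rw [hmi] at hmax
    have hmax' : ((k : ℝ) + 1) / N ≤ ((m : ℝ) + 1) / n (z i) := by
      rw [div_le_div_iff₀ hN hn0]
      exact_mod_cast hmax
    rw [Finset.prod_insert hB]
    have hmul : ∏ j, (1 - (letterCountOn (insert i B) z j : ℝ) / n j) =
        (1 - ((m : ℝ) + 1) / n (z i)) *
          ∏ j ∈ {z i}ᶜ, (1 - (letterCountOn B z j : ℝ) / n j) := by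
      rw [Fintype.prod_eq_mul_prod_compl (z i), hmi, Nat.cast_succ]
      congr 1
      refine Finset.prod_congr rfl fun j hj => ?_
      have : z i ≠ j := by rintro rfl; simp at hj
      simp [letterCountOn_insert hB, this]
    rw [Fintype.prod_eq_mul_prod_compl (z i), ← hm] at ihB
    rw [hmul]
    set R := ∏ j ∈ ({z i} : Finset (Fin d))ᶜ, (1 - (letterCountOn B z j : ℝ) / n j)
    set Q := ∏ i ∈ B, (n (z i) : ℝ) / N
    rw [hBk] at hC
    have hQ : 0 ≤ Q := by positivity
    have hNk : (0 : ℝ) < N - k := by linarith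
    have hu : 0 ≤ 1 - ((m : ℝ) + 1) / n (z i) := by
      rw [sub_nonneg, div_le_one hn0]; exact hmn
    have key : ((typeCylinder n (insert i B) z).card : ℝ) * R ≤
        typeClassCard d N n * ((n (z i) : ℝ) / N * Q) := by
      rw [← mul_le_mul_iff_left₀ hNk]
      calc ((typeCylinder n (insert i B) z).card : ℝ) * R * (N - k)
          = ((typeCylinder n B z).card * ((1 - (m : ℝ) / n (z i)) * R)) * n (z i) := by
            rw [mul_right_comm, hC]; field_simp
        _ ≤ (typeClassCard d N n * Q * (1 - (k : ℝ) / N)) * n (z i) := by gcongr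
        _ = typeClassCard d N n * ((n (z i) : ℝ) / N * Q) * (N - k) := by field_simp
    calc ((typeCylinder n (insert i B) z).card : ℝ) * ((1 - ((m : ℝ) + 1) / n (z i)) * R)
        = ((typeCylinder n (insert i B) z).card * R) * (1 - ((m : ℝ) + 1) / n (z i)) := by ring
      _ ≤ (typeClassCard d N n * ((n (z i) : ℝ) / N * Q)) *
            (1 - ((m : ℝ) + 1) / n (z i)) := by gcongr
      _ ≤ (typeClassCard d N n * ((n (z i) : ℝ) / N * Q)) * (1 - ((k + 1 : ℕ) : ℝ) / N) := by
        push_cast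
        gcongr

theorem card_typeCylinder_mul_one_sub_sum_le (hn : ∑ j, n j = N) (A : Finset (Fin N))
    (z : Fin N → Fin d) :
    ((typeCylinder n A z).card : ℝ) * (1 - ∑ j, (letterCountOn A z j : ℝ) / n j) ≤
      typeClassCard d N n * ∏ i ∈ A, (n (z i) : ℝ) / N := by
  rcases (typeCylinder n A z).eq_empty_or_nonempty with h0 | ⟨x, hx⟩
  · rw [h0, Finset.card_empty, Nat.cast_zero, zero_mul]
    positivity
  rw [mem_typeCylinder] at hx
  have hle : ∀ j, letterCountOn A z j ≤ n j := fun j => by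
    rw [← hx.1 j, ← letterCountOn_congr hx.2]
    exact letterCountOn_le_letterCount A x j
  calc ((typeCylinder n A z).card : ℝ) * (1 - ∑ j, (letterCountOn A z j : ℝ) / n j)
      ≤ (typeCylinder n A z).card * ∏ j, (1 - (letterCountOn A z j : ℝ) / n j) := by
        gcongr
        refine one_sub_sum_le_prod_one_sub _ _ (fun j _ => by positivity) fun j _ => ?_
        exact div_le_one_of_le₀ (by exact_mod_cast hle j) (by positivity)
    _ ≤ _ := card_typeCylinder_mul_prod_le hn A z
    _ ≤ typeClassCard d N n * ∏ i ∈ A, (n (z i) : ℝ) / N := by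
        refine mul_le_of_le_one_right (by positivity) ?_
        have : (0 : ℝ) ≤ (A.card : ℝ) / N := by positivity
        linarith

end Cylinder

/-- The number of strings with letter counts `n` whose first `k` letters are `y`. -/
def typePrefixCount {d N k : ℕ} (hk : k ≤ N) (n : Fin d → ℕ) (y : Fin k → Fin d) : ℕ :=
  (Finset.univ.filter fun x : Fin N → Fin d =>
    (∀ j, letterCount x j = n j) ∧ ∀ i : Fin k, x (Fin.castLE hk i) = y i).card

section Prefix

variable {d N k : ℕ} {n : Fin d → ℕ}

theorem typePrefixCount_mul_one_sub_sum_le (hd : 0 < d) (hk : k ≤ N) (hn : ∑ j, n j = N)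
    (y : Fin k → Fin d) :
    (typePrefixCount hk n y : ℝ) * (1 - ∑ j, (letterCount y j : ℝ) / n j) ≤
      typeClassCard d N n * ∏ i, (n (y i) : ℝ) / N := by
  let z : Fin N → Fin d := fun i => if h : (i : ℕ) < k then y ⟨i, h⟩ else ⟨0, hd⟩
  have hz : ∀ i, z (Fin.castLE hk i) = y i := fun i => by simp [z]
  have h := card_typeCylinder_mul_one_sub_sum_le hn (Finset.univ.map (Fin.castLEEmb hk)) z
  have hcyl : (typeCylinder n (Finset.univ.map (Fin.castLEEmb hk)) z).card =
      typePrefixCount hk n y := by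
    simp [typeCylinder, typePrefixCount, hz]
  have hcount : ∀ j, letterCountOn (Finset.univ.map (Fin.castLEEmb hk)) z j =
      letterCount y j := fun j => by
    simp [letterCountOn, letterCount, Finset.filter_map, Function.comp_def, hz]
  simpa [hcyl, hcount, hz] using h

theorem sum_typePrefixCount_mul (hk : k ≤ N) (n : Fin d → ℕ) (f : (Fin k → Fin d) → ℝ) :
    ∑ y, (typePrefixCount hk n y : ℝ) * f y =
      ∑ x ∈ Finset.univ.filter (fun x : Fin N → Fin d => ∀ j, letterCount x j = n j),
        f fun i => x (Fin.castLE hk i) := by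
  rw [← Finset.sum_fiberwise _ fun (x : Fin N → Fin d) (i : Fin k) => x (Fin.castLE hk i)]
  refine Finset.sum_congr rfl fun y _ => ?_
  rw [Finset.sum_congr rfl fun x hx => congrArg f (Finset.mem_filter.1 hx).2, Finset.sum_const,
    nsmul_eq_mul, Finset.filter_filter]
  simp [typePrefixCount, funext_iff]

theorem card_typeClass_filter_apply_eq_mul (n : Fin d → ℕ) (i : Fin N) (j : Fin d) :
    ((Finset.univ.filter fun x : Fin N → Fin d =>
      (∀ j, letterCount x j = n j) ∧ x i = j).card : ℝ) * N = typeClassCard d N n * n j := by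
  have h := card_typeCylinder_insert_mul (n := n) (A := ∅) (z := fun _ => j)
    (Finset.notMem_empty i)
  simpa [typeClassCard, typeCylinder, letterCountOn] using h

theorem sum_typePrefixCount_mul_letterCount (hk : k ≤ N) (n : Fin d → ℕ) (j : Fin d) :
    (∑ y, (typePrefixCount hk n y : ℝ) * letterCount y j) * N =
      k * (typeClassCard d N n * n j) := by
  rw [sum_typePrefixCount_mul hk n fun y => (letterCount y j : ℝ)]
  simp only [letterCount.eq_1 (k := k), Finset.card_filter, Nat.cast_sum]
  rw [Finset.sum_comm, Finset.sum_mul]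
  rw [Finset.sum_congr rfl fun i _ => ?_, Finset.sum_const, Finset.card_univ, Fintype.card_fin,
    nsmul_eq_mul]
  rw [← card_typeClass_filter_apply_eq_mul n (Fin.castLE hk i) j, ← Finset.filter_filter,
    Finset.card_filter, Nat.cast_sum]

theorem sum_typePrefixCount_mul_sum_letterCount_div_le (hk : k ≤ N) (n : Fin d → ℕ) :
    ∑ y, (typePrefixCount hk n y : ℝ) * ∑ j, (letterCount y j : ℝ) / n j ≤
      typeClassCard d N n * (k * d / N) := by
  simp only [Finset.mul_sum]
  rw [Finset.sum_comm]
  have hj : ∀ j, ∑ y, (typePrefixCount hk n y : ℝ) * ((letterCount y j : ℝ) / n j) ≤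
      typeClassCard d N n * (k / N) := fun j => by
    rcases Nat.eq_zero_or_pos N with rfl | hN
    · obtain rfl : k = 0 := by omega
      simp [letterCount]
    have hN' : (0 : ℝ) < N := by exact_mod_cast hN
    simp only [← mul_div_assoc]
    rw [← Finset.sum_div]
    rcases Nat.eq_zero_or_pos (n j) with h0 | hpos
    · rw [h0, Nat.cast_zero, div_zero]
      positivity
    have hpos' : (0 : ℝ) < n j := by exact_mod_cast hpos
    rw [div_le_iff₀ hpos', div_mul_eq_mul_div, le_div_iff₀ hN',
      sum_typePrefixCount_mul_letterCount]
    exact le_of_eq (by ring)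
  calc _ ≤ ∑ _j : Fin d, (typeClassCard d N n : ℝ) * (k / N) :=
        Finset.sum_le_sum fun j _ => hj j
    _ = typeClassCard d N n * (k * d / N) := by
        rw [Finset.sum_const, Finset.card_univ, Fintype.card_fin, nsmul_eq_mul]
        ring

theorem sum_prod_type_eq_one (hN : 0 < N) (hn : ∑ j, n j = N) :
    ∑ y : Fin k → Fin d, ∏ i, (n (y i) : ℝ) / N = 1 := by
  rw [← Fintype.sum_pow fun j => (n j : ℝ) / N, ← Finset.sum_div, ← Nat.cast_sum, hn,
    div_self (by exact_mod_cast hN.ne'), one_pow]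

theorem sum_abs_typePrefixCount_sub_le (hd : 0 < d) (hN : 0 < N) (hk : k ≤ N)
    (hn : ∑ j, n j = N) :
    ∑ y : Fin k → Fin d,
      |(typePrefixCount hk n y : ℝ) - typeClassCard d N n * ∏ i, (n (y i) : ℝ) / N| ≤
      typeClassCard d N n * (2 * k * d / N) := by
  have hy : ∀ y : Fin k → Fin d,
      |(typePrefixCount hk n y : ℝ) - typeClassCard d N n * ∏ i, (n (y i) : ℝ) / N| ≤
        2 * ((typePrefixCount hk n y : ℝ) * ∑ j, (letterCount y j : ℝ) / n j) -
          (typePrefixCount hk n y - typeClassCard d N n * ∏ i, (n (y i) : ℝ) / N) := fun y => by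
    have h := typePrefixCount_mul_one_sub_sum_le hd hk hn y
    have h0 : 0 ≤ (typePrefixCount hk n y : ℝ) * ∑ j, (letterCount y j : ℝ) / n j := by
      positivity
    rw [abs_le]
    constructor <;> linarith
  have htotal : ∑ y : Fin k → Fin d, (typePrefixCount hk n y : ℝ) = typeClassCard d N n := by
    simpa [typeClassCard] using sum_typePrefixCount_mul hk n fun _ => 1
  refine (Finset.sum_le_sum fun y _ => hy y).trans ?_
  rw [Finset.sum_sub_distrib, Finset.sum_sub_distrib, ← Finset.mul_sum, ← Finset.mul_sum, htotal,
    sum_prod_type_eq_one hN hn, mul_one, sub_self, sub_zero]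
  calc _ ≤ 2 * ((typeClassCard d N n : ℝ) * (k * d / N)) := by
        gcongr
        exact sum_typePrefixCount_mul_sum_letterCount_div_le hk n
    _ = _ := by ring

end Prefix

theorem sum_energy_eq_sum_letterCount_mul {d N : ℕ} (E : Fin d → ℝ) (x : Fin N → Fin d) :
    ∑ i, E (x i) = ∑ j, (letterCount x j : ℝ) * E j := by
  rw [← Finset.sum_fiberwise _ x]
  refine Finset.sum_congr rfl fun j _ => ?_
  rw [Finset.sum_congr rfl fun i hi => congrArg E (Finset.mem_filter.1 hi).2, Finset.sum_const,
    nsmul_eq_mul]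
  rfl

theorem letterCount_mem_typesOfEnergy {d N : ℕ} {E : Fin d → ℝ} {En : ℝ} {x : Fin N → Fin d} :
    letterCount x ∈ typesOfEnergy d N E En ↔ ∑ i, E (x i) = En := by
  rw [typesOfEnergy, Finset.mem_filter, ← sum_energy_eq_sum_letterCount_mul]
  refine ⟨fun h => h.2.2, fun h => ⟨Finset.mem_image.2 ?_, sum_letterCount x, h⟩⟩
  refine ⟨fun j => ⟨letterCount x j, Nat.lt_succ_of_le ?_⟩, Finset.mem_univ _, rfl⟩
  exact (Finset.card_le_univ _).trans_eq (Fintype.card_fin N)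

theorem prefixCount_eq_sum_typePrefixCount {d N k : ℕ} (hk : k ≤ N) (E : Fin d → ℝ) (En : ℝ)
    (y : Fin k → Fin d) :
    prefixCount d N k hk E En y = ∑ n ∈ typesOfEnergy d N E En, typePrefixCount hk n y := by
  unfold prefixCount
  rw [Finset.card_eq_sum_card_fiberwise (f := fun x : Fin N → Fin d => letterCount x)
    (t := typesOfEnergy d N E En)]
  · refine Finset.sum_congr rfl fun n hn => ?_
    unfold typePrefixCount
    congr 1
    ext x
    simp only [Finset.mem_filter, Finset.mem_univ, true_and]
    constructor
    · rintro ⟨⟨_, hy⟩, rfl⟩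
      exact ⟨fun _ => rfl, hy⟩
    · rintro ⟨hx, hy⟩
      obtain rfl : letterCount x = n := funext hx
      exact ⟨⟨letterCount_mem_typesOfEnergy.1 hn, hy⟩, rfl⟩
  · intro x hx
    exact letterCount_mem_typesOfEnergy.2 (Finset.mem_filter.1 hx).2.1

/-- **Trace-norm bound between the shell marginal and the mixture of product states**
(`norm1` bound; total-variation form, equal to the trace norm of the corresponding
diagonal matrices). -/
theorem shellMarginal_close_to_typeMixture
    (d : ℕ) (hd : 2 ≤ d) (E : Fin d → ℝ) (N k : ℕ)
    (hk1 : 1 ≤ k) (hkN : k ≤ N) (En : ℝ) (hach : 0 < gE d N E En) :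
    ∑ y : Fin k → Fin d,
      |(prefixCount d N k hkN E En y : ℝ) / (gE d N E En : ℝ)
        - ∑ n ∈ typesOfEnergy d N E En, muE d N E En n * ∏ i, (n (y i) : ℝ) / N|
      ≤ 2 * k * d / N := by
  have hg : (0 : ℝ) < gE d N E En := by exact_mod_cast hach
  have hsum : ((∑ n ∈ typesOfEnergy d N E En, typeClassCard d N n : ℕ) : ℝ) = gE d N E En := rfl
  have hy : ∀ y : Fin k → Fin d,
      |(prefixCount d N k hkN E En y : ℝ) / (gE d N E En : ℝ)
        - ∑ n ∈ typesOfEnergy d N E En, muE d N E En n * ∏ i, (n (y i) : ℝ) / N| ≤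
      (∑ n ∈ typesOfEnergy d N E En, |(typePrefixCount hkN n y : ℝ)
        - typeClassCard d N n * ∏ i, (n (y i) : ℝ) / N|) / gE d N E En := fun y => by
    have heq : (prefixCount d N k hkN E En y : ℝ) / (gE d N E En : ℝ)
        - ∑ n ∈ typesOfEnergy d N E En, muE d N E En n * ∏ i, (n (y i) : ℝ) / N =
        (∑ n ∈ typesOfEnergy d N E En, ((typePrefixCount hkN n y : ℝ)
          - typeClassCard d N n * ∏ i, (n (y i) : ℝ) / N)) / gE d N E En := by
      rw [prefixCount_eq_sum_typePrefixCount, Finset.sum_sub_distrib, sub_div, Nat.cast_sum,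
        Finset.sum_div _ (fun n => (typeClassCard d N n : ℝ) * _)]
      simp only [muE, div_mul_eq_mul_div]
    rw [heq, abs_div, abs_of_pos hg]
    gcongr
    exact Finset.abs_sum_le_sum_abs _ _
  refine (Finset.sum_le_sum fun y _ => hy y).trans ?_
  rw [← Finset.sum_div, Finset.sum_comm, div_le_iff₀ hg, ← hsum, Nat.cast_sum, Finset.mul_sum]
  refine Finset.sum_le_sum fun n hn => ?_
  rw [mul_comm]
  exact sum_abs_typePrefixCount_sub_le (by omega) (by omega) hkN (Finset.mem_filter.1 hn).2.1

end
end
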